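/- In Version B, a position with exactly four piles is a P-position if and only if its multiset of pile sizes has one of the following forms: (1) {1, 1, a, b} with a and b even; (2) all four pile sizes even; (3) {a, b, c, d} with a even and b, c, d odd with b, c, d ≥ 3. -/

import Mathlib

/-- Remove one token from a pile of size `p` in `G`: delete one copy of `p` and,
if `p ≠ 1`, add back a pile of size `p - 1`. -/
def takeOne (G : Multiset ℕ) (p : ℕ) : Multiset ℕ :=
  G.erase p + (if p = 1 then (0 : Multiset ℕ) else {p - 1})

/-- Legal moves of Version B: remove one token from one chosen pile, or remove
one token from every pile simultaneously (piles reaching size 0 are deleted). -/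
inductive MoveB : Multiset ℕ → Multiset ℕ → Prop
  | one {G : Multiset ℕ} {p : ℕ} (hp : p ∈ G) (h1 : 1 ≤ p) : MoveB G (takeOne G p)
  | all {G : Multiset ℕ} (hG : G ≠ 0) : MoveB G ((G.map (· - 1)).filter (· ≠ 0))

mutual
  /-- P-positions of Version B under normal play: every move leads to an N-position
  (in particular the empty position is a P-position).  Since every move strictly
  decreases the total number of tokens, this inductive definition agrees with the
  usual recursive definition of outcome classes. -/
  inductive PPosB : Multiset ℕ → Prop
    | mk : ∀ {G : Multiset ℕ}, (∀ H, MoveB G H → NPosB H) → PPosB G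
  /-- N-positions of Version B under normal play: some move leads to a P-position. -/
  inductive NPosB : Multiset ℕ → Prop
    | mk : ∀ {G H : Multiset ℕ}, MoveB G H → PPosB H → NPosB G
end

/-- The number of piles of size one. -/
def onesB (G : Multiset ℕ) : ℕ := G.countP (· = 1)

/-- The number of piles of size two. -/
def twosB (G : Multiset ℕ) : ℕ := G.countP (· = 2)

/-- The number of piles of odd size at least three. -/
def oddsB (G : Multiset ℕ) : ℕ := G.countP (fun p => p % 2 = 1 ∧ 3 ≤ p)

/-- The number of piles of even size at least four. -/
def evensB (G : Multiset ℕ) : ℕ := G.countP (fun p => p % 2 = 0 ∧ 4 ≤ p)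

/-- The closed form of the P-positions with at most four piles. -/
def IsClosedFormB (G : Multiset ℕ) : Prop :=
  (onesB G = 0 ∧ oddsB G = 0) ∨
  (twosB G + evensB G = 1 ∧ onesB G + oddsB G = 2) ∨
  (twosB G + evensB G = 1 ∧ onesB G = 0 ∧ oddsB G = 3) ∨
  (onesB G = 2 ∧ twosB G + evensB G = 2 ∧ oddsB G = 0)

theorem counts_add (G : Multiset ℕ) (hG : 0 ∉ G) :
    onesB G + twosB G + oddsB G + evensB G = Multiset.card G := by
  induction G using Multiset.induction with
  | empty => simp [onesB, twosB, oddsB, evensB]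
  | cons p s ih =>
    have h0 : 0 ∉ s := fun h => hG (Multiset.mem_cons_of_mem h)
    have hp : p ≠ 0 := by rintro rfl; exact hG (Multiset.mem_cons_self _ _)
    have := ih h0
    simp only [onesB, twosB, oddsB, evensB, Multiset.countP_cons, Multiset.card_cons] at this ⊢
    split_ifs <;> omega

/-- The position reached by lowering every pile. -/
def takeAll (G : Multiset ℕ) : Multiset ℕ := (G.map (· - 1)).filter (· ≠ 0)

theorem takeAll_cons (p : ℕ) (s : Multiset ℕ) :
    takeAll (p ::ₘ s) = if p ≤ 1 then takeAll s else (p - 1) ::ₘ takeAll s := by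
  unfold takeAll
  split_ifs with h
  · rw [Multiset.map_cons, Multiset.filter_cons_of_neg]; omega
  · rw [Multiset.map_cons, Multiset.filter_cons_of_pos]; omega

theorem zero_notMem_takeAll (G : Multiset ℕ) : 0 ∉ takeAll G := by
  simp [takeAll]

theorem counts_takeAll (G : Multiset ℕ) :
    onesB (takeAll G) = twosB G ∧ twosB (takeAll G) + evensB (takeAll G) = oddsB G ∧
      oddsB (takeAll G) = evensB G := by
  induction G using Multiset.induction with
  | empty => simp [takeAll, onesB, twosB, oddsB, evensB]
  | cons p s ih =>
    rw [takeAll_cons]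
    split_ifs with h <;>
    simp only [onesB, twosB, oddsB, evensB, Multiset.countP_cons] at ih ⊢ <;>
    refine ⟨?_, ?_, ?_⟩ <;> split_ifs <;> omega

theorem sum_takeAll (G : Multiset ℕ) (hG : 0 ∉ G) :
    (takeAll G).sum + Multiset.card G = G.sum := by
  induction G using Multiset.induction with
  | empty => simp [takeAll]
  | cons p s ih =>
    have h0 : 0 ∉ s := fun h => hG (Multiset.mem_cons_of_mem h)
    have hp : p ≠ 0 := by rintro rfl; exact hG (Multiset.mem_cons_self _ _)
    have := ih h0
    rw [takeAll_cons]
    split_ifs <;> simp only [Multiset.sum_cons, Multiset.card_cons] <;> omega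

theorem card_takeAll_le (G : Multiset ℕ) : Multiset.card (takeAll G) ≤ Multiset.card G := by
  simpa [takeAll] using Multiset.card_le_card (Multiset.filter_le (· ≠ 0) (G.map (· - 1)))

theorem takeOne_cons (p : ℕ) (s : Multiset ℕ) :
    takeOne (p ::ₘ s) p = if p = 1 then s else (p - 1) ::ₘ s := by
  unfold takeOne
  split_ifs with h
  · simp
  · rw [Multiset.erase_cons_head, add_comm, Multiset.singleton_add]

theorem takeOne_spec {G : Multiset ℕ} {p : ℕ} (hG : 0 ∉ G) (hp : p ∈ G) :
    0 ∉ takeOne G p ∧ (takeOne G p).sum < G.sum ∧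
      Multiset.card (takeOne G p) ≤ Multiset.card G := by
  obtain ⟨s, rfl⟩ := Multiset.exists_cons_of_mem hp
  have h0 : 0 ∉ s := fun h => hG (Multiset.mem_cons_of_mem h)
  have hp : p ≠ 0 := by rintro rfl; exact hG (Multiset.mem_cons_self _ _)
  rw [takeOne_cons]
  split_ifs with h
  · simp [h0, h]
  · simp only [Multiset.mem_cons, Multiset.sum_cons, Multiset.card_cons]
    refine ⟨?_, by omega, le_rfl⟩
    rintro (h | h)
    · omega
    · exact h0 h

theorem counts_takeOne_one {G : Multiset ℕ} (hp : 1 ∈ G) :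
    onesB (takeOne G 1) + 1 = onesB G ∧ twosB (takeOne G 1) = twosB G ∧
      oddsB (takeOne G 1) = oddsB G ∧ evensB (takeOne G 1) = evensB G := by
  obtain ⟨s, rfl⟩ := Multiset.exists_cons_of_mem hp
  simp [takeOne_cons, onesB, twosB, oddsB, evensB]

theorem counts_takeOne_two {G : Multiset ℕ} (hp : 2 ∈ G) :
    onesB (takeOne G 2) = onesB G + 1 ∧ twosB (takeOne G 2) + 1 = twosB G ∧
      oddsB (takeOne G 2) = oddsB G ∧ evensB (takeOne G 2) = evensB G := by
  obtain ⟨s, rfl⟩ := Multiset.exists_cons_of_mem hp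
  simp [takeOne_cons, onesB, twosB, oddsB, evensB]

theorem counts_takeOne_odd {G : Multiset ℕ} {p : ℕ} (hp : p ∈ G) (h : p % 2 = 1 ∧ 3 ≤ p) :
    onesB (takeOne G p) = onesB G ∧ oddsB (takeOne G p) + 1 = oddsB G ∧
      twosB (takeOne G p) + evensB (takeOne G p) = twosB G + evensB G + 1 := by
  obtain ⟨s, rfl⟩ := Multiset.exists_cons_of_mem hp
  rw [takeOne_cons, if_neg (by omega)]
  simp only [onesB, twosB, oddsB, evensB, Multiset.countP_cons]
  refine ⟨?_, ?_, ?_⟩ <;> split_ifs <;> omega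

theorem counts_takeOne_even {G : Multiset ℕ} {p : ℕ} (hp : p ∈ G) (h : p % 2 = 0 ∧ 4 ≤ p) :
    onesB (takeOne G p) = onesB G ∧ oddsB (takeOne G p) = oddsB G + 1 ∧
      twosB (takeOne G p) = twosB G ∧ evensB (takeOne G p) + 1 = evensB G := by
  obtain ⟨s, rfl⟩ := Multiset.exists_cons_of_mem hp
  rw [takeOne_cons, if_neg (by omega)]
  simp only [onesB, twosB, oddsB, evensB, Multiset.countP_cons]
  refine ⟨?_, ?_, ?_, ?_⟩ <;> split_ifs <;> omega

theorem MoveB.spec {G H : Multiset ℕ} (h : MoveB G H) (hG : 0 ∉ G) :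
    0 ∉ H ∧ H.sum < G.sum ∧ Multiset.card H ≤ Multiset.card G := by
  cases h with
  | one hp _ => exact takeOne_spec hG hp
  | all hne =>
    have := sum_takeAll G hG
    have := Multiset.card_pos.2 hne
    exact ⟨zero_notMem_takeAll G, show (takeAll G).sum < _ by omega, card_takeAll_le G⟩

/-- No move joins two positions of the closed form. -/
theorem not_isClosedFormB_of_moveB {G H : Multiset ℕ} (hG : 0 ∉ G) (hc : Multiset.card G ≤ 4)
    (hw : IsClosedFormB G) (h : MoveB G H) : ¬ IsClosedFormB H := by
  have hsum := counts_add G hG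
  unfold IsClosedFormB at hw
  cases h with
  | @one p hp h1 =>
    have hcases : p = 1 ∨ p = 2 ∨ (p % 2 = 1 ∧ 3 ≤ p) ∨ (p % 2 = 0 ∧ 4 ≤ p) := by omega
    rcases hcases with rfl | rfl | h | h
    · have := counts_takeOne_one hp
      unfold IsClosedFormB
      omega
    · have := counts_takeOne_two hp
      unfold IsClosedFormB
      omega
    · have := counts_takeOne_odd hp h
      unfold IsClosedFormB
      omega
    · have := counts_takeOne_even hp h
      unfold IsClosedFormB
      omega
  | all hne =>
    have := counts_takeAll G
    have := Multiset.card_pos.2 hne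
    change ¬ IsClosedFormB (takeAll G)
    unfold IsClosedFormB
    omega

/-- Every position outside the closed form has a move into it. -/
theorem exists_moveB_isClosedFormB {G : Multiset ℕ} (hG : 0 ∉ G) (hc : Multiset.card G ≤ 4)
    (hw : ¬ IsClosedFormB G) : ∃ H, MoveB G H ∧ IsClosedFormB H := by
  have hsum := counts_add G hG
  by_contra! hno
  have hne : G ≠ 0 := by
    rintro rfl
    simp [IsClosedFormB, onesB, oddsB] at hw
  have hall : ¬ IsClosedFormB (takeAll G) := hno _ (MoveB.all hne)
  have hA := counts_takeAll G
  unfold IsClosedFormB at hw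
  by_cases hE : twosB G + evensB G = 0
  · exact hall (Or.inl (by omega))
  by_cases hu : 0 < onesB G ∧ (onesB G + oddsB G = 1 ∨ onesB G + oddsB G = 3)
  · obtain ⟨p, hp, rfl⟩ := Multiset.countP_pos.1 hu.1
    have h := counts_takeOne_one hp
    refine hno _ (MoveB.one hp le_rfl) ?_
    rcases hu.2 with hu | hu
    · exact Or.inl (by omega)
    · exact Or.inr (Or.inl (by omega))
  by_cases ho : 0 < oddsB G ∧ oddsB G = 1 ∧ onesB G = 0
  · obtain ⟨p, hp, hp3⟩ := Multiset.countP_pos.1 ho.1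
    have h := counts_takeOne_odd hp hp3
    exact hno _ (MoveB.one hp (by omega)) (Or.inl (by omega))
  have hE2 : twosB G + evensB G = 2 ∧ onesB G + oddsB G = 2 ∧ onesB G ≠ 2 := by
    clear hA
    omega
  clear hw hu ho hE
  by_cases he : 0 < evensB G ∧ oddsB G = 2
  · obtain ⟨p, hp, hp4⟩ := Multiset.countP_pos.1 he.1
    have h := counts_takeOne_even hp hp4
    exact hno _ (MoveB.one hp (by omega)) (Or.inr (Or.inr (Or.inl (by omega))))
  by_cases hu : onesB G = 1
  · exact hall (Or.inr (Or.inl (by omega)))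
  · exact hall (Or.inr (Or.inr (Or.inr (by omega))))

theorem posB_iff_isClosedFormB {G : Multiset ℕ} (hG : 0 ∉ G) (hc : Multiset.card G ≤ 4) :
    (PPosB G ↔ IsClosedFormB G) ∧ (NPosB G ↔ ¬ IsClosedFormB G) := by
  induction hn : G.sum using Nat.strong_induction_on generalizing G with
  | _ n ih =>
    have step {H : Multiset ℕ} (h : MoveB G H) :
        (PPosB H ↔ IsClosedFormB H) ∧ (NPosB H ↔ ¬ IsClosedFormB H) := by
      obtain ⟨h0, hlt, hle⟩ := h.spec hG
      exact ih _ (hn ▸ hlt) h0 (hle.trans hc) rfl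
    refine ⟨⟨?_, fun hw => ⟨fun H h => (step h).2.2 (not_isClosedFormB_of_moveB hG hc hw h)⟩⟩,
      ⟨?_, fun hw => ?_⟩⟩
    · rintro ⟨hall⟩
      by_contra hw
      obtain ⟨H, h, hH⟩ := exists_moveB_isClosedFormB hG hc hw
      exact (step h).2.1 (hall H h) hH
    · rintro ⟨h, hP⟩ hw
      exact not_isClosedFormB_of_moveB hG hc hw h ((step h).1.1 hP)
    · obtain ⟨H, h, hH⟩ := exists_moveB_isClosedFormB hG hc hw
      exact ⟨h, (step h).1.2 hH⟩

theorem onesB_eq_zero_and_oddsB_eq_zero {G : Multiset ℕ} :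
    onesB G = 0 ∧ oddsB G = 0 ↔ ∀ p ∈ G, Even p := by
  simp only [onesB, oddsB, Multiset.countP_eq_zero, Nat.even_iff]
  constructor
  · rintro ⟨h1, h3⟩ p hp
    have := h1 p hp
    have := h3 p hp
    omega
  · intro h
    constructor <;> intro p hp <;> have := h p hp <;> omega

theorem exists_eq_one_one_even_even {G : Multiset ℕ} (hcard : Multiset.card G = 4)
    (h1 : onesB G = 2) (h3 : oddsB G = 0) :
    ∃ a b, Even a ∧ Even b ∧ G = {1, 1, a, b} := by
  have hsplit := Multiset.filter_add_not (· = 1) G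
  have hc := congrArg Multiset.card hsplit
  rw [onesB, Multiset.countP_eq_card_filter] at h1
  rw [Multiset.card_add, h1, hcard] at hc
  have hrest : Multiset.card (G.filter (¬ · = 1)) = 2 := by omega
  obtain ⟨x, y, hxy⟩ := Multiset.card_eq_two.1 h1
  obtain ⟨a, b, hab⟩ := Multiset.card_eq_two.1 hrest
  have hone : ∀ p ∈ ({x, y} : Multiset ℕ), p = 1 := by
    intro p hp
    rw [← hxy] at hp
    exact (Multiset.mem_filter.1 hp).2
  have heven : ∀ p ∈ ({a, b} : Multiset ℕ), Even p := by
    intro p hp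
    rw [← hab] at hp
    have h := Multiset.mem_filter.1 hp
    have := Multiset.countP_eq_zero.1 h3 p h.1
    rw [Nat.even_iff]
    omega
  obtain rfl := hone x (by simp)
  obtain rfl := hone y (by simp)
  refine ⟨a, b, heven a (by simp), heven b (by simp), ?_⟩
  rw [← hsplit, hxy, hab]
  rfl

theorem exists_eq_even_odd_odd_odd {G : Multiset ℕ} (hcard : Multiset.card G = 4)
    (h1 : onesB G = 0) (h3 : oddsB G = 3) :
    ∃ a b c d, Even a ∧ Odd b ∧ Odd c ∧ Odd d ∧ 3 ≤ b ∧ 3 ≤ c ∧ 3 ≤ d ∧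
      G = {a, b, c, d} := by
  have hsplit := Multiset.filter_add_not (fun p => p % 2 = 1 ∧ 3 ≤ p) G
  have hc := congrArg Multiset.card hsplit
  rw [oddsB, Multiset.countP_eq_card_filter] at h3
  rw [Multiset.card_add, h3, hcard] at hc
  have hrest : Multiset.card (G.filter fun p => ¬ (p % 2 = 1 ∧ 3 ≤ p)) = 1 := by omega
  obtain ⟨b, c, d, hbcd⟩ := Multiset.card_eq_three.1 h3
  obtain ⟨a, ha⟩ := Multiset.card_eq_one.1 hrest
  have hodd : ∀ p ∈ ({b, c, d} : Multiset ℕ), p % 2 = 1 ∧ 3 ≤ p := by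
    intro p hp
    rw [← hbcd] at hp
    exact (Multiset.mem_filter (p := fun p => p % 2 = 1 ∧ 3 ≤ p).1 hp).2
  have heven : Even a := by
    have h := Multiset.mem_filter.1 (ha ▸ Multiset.mem_singleton_self a)
    have := Multiset.countP_eq_zero.1 h1 a h.1
    rw [Nat.even_iff]
    omega
  have hb := hodd b (by simp)
  have hc := hodd c (by simp)
  have hd := hodd d (by simp)
  refine ⟨a, b, c, d, heven, Nat.odd_iff.2 hb.1, Nat.odd_iff.2 hc.1, Nat.odd_iff.2 hd.1,
    hb.2, hc.2, hd.2, ?_⟩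
  rw [← hsplit, hbcd, ha, add_comm]
  rfl

/-- In Version B, a four-pile position is a P-position iff it has one of the forms:
`{1, 1, even, even}`; all four piles even; or one even pile together with three odd
piles each of size at least 3. -/
theorem versionB_four_piles (G : Multiset ℕ) (hG : 0 ∉ G)
    (hcard : Multiset.card G = 4) :
    PPosB G ↔
      (∃ a b, Even a ∧ Even b ∧ G = {1, 1, a, b}) ∨
      (∀ p ∈ G, Even p) ∨
      (∃ a b c d, Even a ∧ Odd b ∧ Odd c ∧ Odd d ∧ 3 ≤ b ∧ 3 ≤ c ∧ 3 ≤ d ∧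
        G = {a, b, c, d}) := by
  rw [(posB_iff_isClosedFormB hG hcard.le).1]
  constructor
  · intro hw
    have hsum := counts_add G hG
    rcases hw with h | h | h | h
    · exact Or.inr (Or.inl (onesB_eq_zero_and_oddsB_eq_zero.1 h))
    · omega
    · exact Or.inr (Or.inr (exists_eq_even_odd_odd_odd hcard h.2.1 h.2.2))
    · exact Or.inl (exists_eq_one_one_even_even hcard h.1 h.2.2)
  · rintro (⟨a, b, ha, hb, rfl⟩ | h | ⟨a, b, c, d, ha, hb, hc, hd, hb3, hc3, hd3, rfl⟩)
    · have hsum := counts_add _ hG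
      have h1 : onesB {1, 1, a, b} = 2 := by
        rw [Nat.even_iff] at ha hb
        simp only [onesB, Multiset.insert_eq_cons, ← Multiset.cons_zero, Multiset.countP_cons,
          Multiset.countP_zero]
        split_ifs <;> omega
      have h3 : oddsB {1, 1, a, b} = 0 := by
        rw [Nat.even_iff] at ha hb
        simp only [oddsB, Multiset.insert_eq_cons, ← Multiset.cons_zero, Multiset.countP_cons,
          Multiset.countP_zero]
        split_ifs <;> omega
      unfold IsClosedFormB
      omega
    · exact Or.inl (onesB_eq_zero_and_oddsB_eq_zero.2 h)
    · have hsum := counts_add _ hG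
      rw [Nat.even_iff] at ha
      rw [Nat.odd_iff] at hb hc hd
      have h1 : onesB {a, b, c, d} = 0 := by
        simp only [onesB, Multiset.insert_eq_cons, ← Multiset.cons_zero, Multiset.countP_cons,
          Multiset.countP_zero]
        split_ifs <;> omega
      have h3 : oddsB {a, b, c, d} = 3 := by
        simp only [oddsB, Multiset.insert_eq_cons, ← Multiset.cons_zero, Multiset.countP_cons,
          Multiset.countP_zero]
        split_ifs <;> omega
      unfold IsClosedFormB
      omega
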